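/- Let $A$ be a real $d\times n$ matrix with columns $a_1,\dots,a_n$, and let $P=\mathrm{conv}\{\pm a_1,\dots,\pm a_n\}\subset\mathbb{R}^d$. Assume that $P$ has the $2n$ signed atoms as its $2n$ vertices, i.e. the $2n$ points $\pm a_1,\dots,\pm a_n$ are pairwise distinct and are exactly the extreme points of $P$. Let $0\le k\le n$. A face of $P$ is either $P$ itself or a set $\{z\in P: w^Tz=b\}$ where $w\in\mathbb{R}^d$, $b\in\mathbb{R}$ and $w^Tz\le b$ for all $z\in P$. Call $P$ $k$-neighbourly if for every set of $k$ distinct indices $i_1<\dots<i_k$ and all signs $\sigma_1,\dots,\sigma_k\in\{-1,+1\}$, the points $\sigma_1a_{i_1},\dots,\sigma_ka_{i_k}$ are affinely independent and their convex hull is a face of $P$. Then $P$ is $k$-neighbourly if and only if for every $y\in\mathbb{R}^d$ and every $x_0\in\mathbb{R}^n$ with $Ax_0=y$ and at most $k$ nonzero entries, $x_0$ is the unique minimizer of $\|x\|_1$ over $\{x\in\mathbb{R}^n: Ax=y\}$. -/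

import Mathlib

open Matrix

/-- `F` is a face of `P`: either `F = P`, or `F` is the set of points of `P` at which a valid
inequality `wᵀ z ≤ b` holds with equality (`w = 0`, `b = 1` gives the empty face). -/
def IsFace {d : ℕ} (P F : Set (Fin d → ℝ)) : Prop :=
  F = P ∨ ∃ (w : Fin d → ℝ) (b : ℝ), (∀ z ∈ P, w ⬝ᵥ z ≤ b) ∧ F = {z ∈ P | w ⬝ᵥ z = b}

/-- The set `{±a_1, …, ±a_n}` of the columns of `A` and their negatives. -/
def signedAtoms {d n : ℕ} (A : Matrix (Fin d) (Fin n) ℝ) : Set (Fin d → ℝ) :=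
  {v | ∃ i, v = A.transpose i ∨ v = -(A.transpose i)}

/-- The centrally symmetric polytope `P = conv{±a_1, …, ±a_n}`. -/
def signedAtomPolytope {d n : ℕ} (A : Matrix (Fin d) (Fin n) ℝ) : Set (Fin d → ℝ) :=
  convexHull ℝ (signedAtoms A)

/-- `P = conv{±a_1, …, ±a_n}` is a polytope whose `2n` vertices are the signed atoms: the `2n`
points `±a_i` are pairwise distinct, and they are exactly the extreme points of `P`. -/
structure HasAllVertices {d n : ℕ} (A : Matrix (Fin d) (Fin n) ℝ) : Prop where
  injective : Function.Injective A.transpose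
  ne_neg : ∀ i j, A.transpose i ≠ -(A.transpose j)
  vertices_eq : (signedAtomPolytope A).extremePoints ℝ = signedAtoms A

/-- `P = conv{±a_1, …, ±a_n}` is `k`-neighbourly: every choice of `k` distinct columns of `A`
with arbitrary signs gives affinely independent points whose convex hull is a face of `P`
(hence a `(k-1)`-simplex which is a face of `P`). -/
def Neighbourly {d n : ℕ} (A : Matrix (Fin d) (Fin n) ℝ) (k : ℕ) : Prop :=
  ∀ s : Finset (Fin n), s.card = k → ∀ σ : Fin n → ℝ, (∀ i ∈ s, σ i = 1 ∨ σ i = -1) →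
    AffineIndependent ℝ (fun i : s => σ i.val • A.transpose i.val) ∧
    IsFace (signedAtomPolytope A) (convexHull ℝ {v | ∃ i ∈ s, v = σ i • A.transpose i})

/-- `x` minimizes `‖x‖₁` subject to `A x = y`. -/
def IsL1Minimizer {d n : ℕ} (A : Matrix (Fin d) (Fin n) ℝ) (y : Fin d → ℝ) (x : Fin n → ℝ) :
    Prop :=
  A *ᵥ x = y ∧ ∀ x' : Fin n → ℝ, A *ᵥ x' = y → ∑ i, |x i| ≤ ∑ i, |x' i|

/-- `x` is the unique minimizer of `‖x‖₁` subject to `A x = y`. -/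
def IsUniqueL1Minimizer {d n : ℕ} (A : Matrix (Fin d) (Fin n) ℝ) (y : Fin d → ℝ)
    (x : Fin n → ℝ) : Prop :=
  IsL1Minimizer A y x ∧ ∀ x' : Fin n → ℝ, IsL1Minimizer A y x' → x' = x

/-- `A x` as a linear combination of the columns of `A`. -/
theorem mulVec_eq_sum_smul_column {d n : ℕ} (A : Matrix (Fin d) (Fin n) ℝ) (x : Fin n → ℝ) :
    A *ᵥ x = ∑ i, x i • A.transpose i := by
  ext j
  simp [Matrix.mulVec, dotProduct, mul_comm]

theorem dotProduct_mulVec_eq_sum_column {d n : ℕ} (A : Matrix (Fin d) (Fin n) ℝ)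
    (w : Fin d → ℝ) (x : Fin n → ℝ) :
    w ⬝ᵥ (A *ᵥ x) = ∑ i, x i * (w ⬝ᵥ A.transpose i) := by
  rw [mulVec_eq_sum_smul_column, dotProduct_sum]
  simp

theorem mulVec_eq_sum_smul_column_of_support {d n : ℕ} (A : Matrix (Fin d) (Fin n) ℝ)
    {s : Finset (Fin n)} {x : Fin n → ℝ} (hx : ∀ i, i ∉ s → x i = 0) :
    A *ᵥ x = ∑ i ∈ s, x i • A.transpose i := by
  rw [mulVec_eq_sum_smul_column]
  refine (Finset.sum_subset (Finset.subset_univ s) fun i _ hi => ?_).symm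
  rw [hx i hi, zero_smul]

theorem card_filter_ne_zero_le {n : ℕ} {s : Finset (Fin n)} {x : Fin n → ℝ}
    (hx : ∀ i, i ∉ s → x i = 0) : (Finset.univ.filter fun i => x i ≠ 0).card ≤ s.card := by
  refine Finset.card_le_card fun i hi => ?_
  by_contra h
  exact (Finset.mem_filter.1 hi).2 (hx i h)

/-- The convex set `{A x : ‖x‖₁ ≤ 1, x vanishes on s}`. -/
def crossImageOff {d n : ℕ} (A : Matrix (Fin d) (Fin n) ℝ) (s : Finset (Fin n)) :
    Set (Fin d → ℝ) :=
  (fun x => A *ᵥ x) '' {x | ∑ i, |x i| ≤ 1 ∧ ∀ i ∈ s, x i = 0}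

theorem convex_crossImageOff {d n : ℕ} (A : Matrix (Fin d) (Fin n) ℝ) (s : Finset (Fin n)) :
    Convex ℝ (crossImageOff A s) := by
  refine Convex.is_linear_image (f := fun x => A *ᵥ x) ?_
    ⟨fun x y => Matrix.mulVec_add A x y, fun c x => Matrix.mulVec_smul A c x⟩
  rintro x ⟨hx, hxs⟩ y ⟨hy, hys⟩ a b ha hb hab
  refine ⟨?_, fun i hi => by simp [hxs i hi, hys i hi]⟩
  calc ∑ i, |(a • x + b • y) i| ≤ ∑ i, (a * |x i| + b * |y i|) := by
        refine Finset.sum_le_sum fun i _ => (abs_add_le _ _).trans_eq ?_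
        simp [abs_mul, abs_of_nonneg ha, abs_of_nonneg hb]
    _ = a * ∑ i, |x i| + b * ∑ i, |y i| := by
        rw [Finset.sum_add_distrib, Finset.mul_sum, Finset.mul_sum]
    _ ≤ a * 1 + b * 1 := by gcongr
    _ = 1 := by linarith

theorem isCompact_crossImageOff {d n : ℕ} (A : Matrix (Fin d) (Fin n) ℝ) (s : Finset (Fin n)) :
    IsCompact (crossImageOff A s) := by
  refine IsCompact.image ?_ (Continuous.matrix_mulVec continuous_const continuous_id)
  refine Metric.isCompact_of_isClosed_isBounded ?_ ?_
  · simp only [Set.ofPred_and, Set.ofPred_forall]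
    refine (isClosed_le (by fun_prop) continuous_const).inter ?_
    exact isClosed_iInter fun i => isClosed_iInter fun _ =>
      isClosed_eq (continuous_apply i) continuous_const
  · refine (Metric.isBounded_closedBall (x := (0 : Fin n → ℝ)) (r := 1)).subset ?_
    rintro x ⟨hx, -⟩
    rw [mem_closedBall_zero_iff, pi_norm_le_iff_of_nonneg zero_le_one]
    intro i
    exact (Finset.single_le_sum (f := fun i => |x i|) (fun j _ => abs_nonneg _)
      (Finset.mem_univ i)).trans hx

theorem smul_column_mem_crossImageOff {d n : ℕ} (A : Matrix (Fin d) (Fin n) ℝ)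
    {s : Finset (Fin n)} {j : Fin n} (hj : j ∉ s) {c : ℝ} (hc : |c| ≤ 1) :
    c • A.transpose j ∈ crossImageOff A s := by
  classical
  refine ⟨Pi.single j c, ⟨?_, fun i hi => ?_⟩, ?_⟩
  · rw [Finset.sum_eq_single j (fun i _ hij => by simp [hij]) (by simp)]
    simpa using hc
  · exact Pi.single_eq_of_ne (by rintro rfl; exact hj hi) _
  · ext i
    simp [mul_comm]

theorem signedAtomPolytope_subset_crossImageOff_empty {d n : ℕ} (A : Matrix (Fin d) (Fin n) ℝ) :
    signedAtomPolytope A ⊆ crossImageOff A ∅ := by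
  refine convexHull_min ?_ (convex_crossImageOff A ∅)
  rintro v ⟨i, rfl | rfl⟩
  · simpa using smul_column_mem_crossImageOff A (Finset.notMem_empty i) (c := 1) (by simp)
  · simpa using smul_column_mem_crossImageOff A (Finset.notMem_empty i) (c := -1) (by simp)

theorem sign_smul_column_mem_signedAtoms {d n : ℕ} (A : Matrix (Fin d) (Fin n) ℝ) (i : Fin n)
    {c : ℝ} (hc : c = 1 ∨ c = -1) : c • A.transpose i ∈ signedAtoms A := by
  rcases hc with rfl | rfl
  · exact ⟨i, Or.inl (by simp)⟩
  · exact ⟨i, Or.inr (by simp)⟩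

/-- Distinct signed atoms have distinct representations as a sign times a column. -/
theorem HasAllVertices.sign_smul_column_inj {d n : ℕ} {A : Matrix (Fin d) (Fin n) ℝ}
    (hA : HasAllVertices A) {i j : Fin n} {c e : ℝ} (hc : c = 1 ∨ c = -1) (he : e = 1 ∨ e = -1)
    (h : c • A.transpose i = e • A.transpose j) : i = j ∧ c = e := by
  rcases hc with rfl | rfl <;> rcases he with rfl | rfl <;>
    simp only [one_smul, neg_smul, neg_inj] at h
  · exact ⟨hA.injective h, rfl⟩
  · exact absurd h (hA.ne_neg i j)
  · exact absurd h.symm (hA.ne_neg j i)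
  · exact ⟨hA.injective h, rfl⟩

/-- A signed atom lying in the hull of some signed atoms is one of them. -/
theorem HasAllVertices.mem_of_mem_convexHull {d n : ℕ} {A : Matrix (Fin d) (Fin n) ℝ}
    (hA : HasAllVertices A) {S : Set (Fin d → ℝ)} (hS : S ⊆ signedAtoms A) {v : Fin d → ℝ}
    (hv : v ∈ signedAtoms A) (hvS : v ∈ convexHull ℝ S) : v ∈ S := by
  rw [← hA.vertices_eq] at hv
  exact extremePoints_convexHull_subset
    (inter_extremePoints_subset_extremePoints_of_subset (convexHull_mono hS) ⟨hvS, hv⟩)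

/-- If the hull of the points `σ i • a_i`, `i ∈ s`, is a face of `P`, there is a functional
equal to `b > 0` at those points and of absolute value `< b` at all other atoms. -/
theorem HasAllVertices.exists_certificate_of_isFace {d n : ℕ} {A : Matrix (Fin d) (Fin n) ℝ}
    (hA : HasAllVertices A) {s : Finset (Fin n)} (hn : 0 < n) {σ : Fin n → ℝ}
    (hσ : ∀ i ∈ s, σ i = 1 ∨ σ i = -1)
    (hF : IsFace (signedAtomPolytope A) (convexHull ℝ {v | ∃ i ∈ s, v = σ i • A.transpose i})) :
    ∃ (w : Fin d → ℝ) (b : ℝ), 0 < b ∧ (∀ i ∈ s, w ⬝ᵥ A.transpose i = σ i * b) ∧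
      ∀ j, j ∉ s → |w ⬝ᵥ A.transpose j| < b := by
  set S : Set (Fin d → ℝ) := {v | ∃ i ∈ s, v = σ i • A.transpose i} with hSdef
  have hS : S ⊆ signedAtoms A := by
    rintro v ⟨i, hi, rfl⟩
    exact sign_smul_column_mem_signedAtoms A i (hσ i hi)
  have hne : convexHull ℝ S ≠ signedAtomPolytope A := by
    intro h
    have key : ∀ v ∈ signedAtoms A, v ∈ S := fun v hv =>
      hA.mem_of_mem_convexHull hS hv (h ▸ subset_convexHull ℝ _ hv)
    let i₀ : Fin n := ⟨0, hn⟩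
    obtain ⟨i, hi, h1⟩ := key _ (sign_smul_column_mem_signedAtoms A i₀ (Or.inl rfl))
    obtain ⟨j, hj, h2⟩ := key _ (sign_smul_column_mem_signedAtoms A i₀ (Or.inr rfl))
    obtain ⟨rfl, h1⟩ := hA.sign_smul_column_inj (Or.inl rfl) (hσ i hi) h1
    obtain ⟨rfl, h2⟩ := hA.sign_smul_column_inj (Or.inr rfl) (hσ j hj) h2
    linarith
  rcases hF with hF | ⟨w, b, hwb, hF⟩
  · exact absurd hF hne
  have hle : ∀ i, |w ⬝ᵥ A.transpose i| ≤ b := by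
    intro i
    rw [abs_le']
    have h1 := hwb _ (subset_convexHull ℝ _ ⟨i, Or.inl rfl⟩)
    have h2 := hwb _ (subset_convexHull ℝ _ ⟨i, Or.inr rfl⟩)
    rw [dotProduct_neg] at h2
    exact ⟨h1, h2⟩
  have hb0 : 0 ≤ b := (abs_nonneg _).trans (hle ⟨0, hn⟩)
  have hb : 0 < b := by
    refine hb0.lt_of_ne fun hb => hne ?_
    rw [hF]
    refine Set.Subset.antisymm (Set.sep_subset _ _) fun z hz => ⟨hz, ?_⟩
    obtain ⟨x, -, rfl⟩ := signedAtomPolytope_subset_crossImageOff_empty A hz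
    rw [dotProduct_mulVec_eq_sum_column, ← hb]
    refine Finset.sum_eq_zero fun i _ => ?_
    have h0 : w ⬝ᵥ A.transpose i = 0 := abs_nonpos_iff.1 ((hle i).trans_eq hb.symm)
    rw [h0, mul_zero]
  refine ⟨w, b, hb, fun i hi => ?_, fun j hj => (hle j).lt_of_ne fun hjb => ?_⟩
  · have h : σ i • A.transpose i ∈ convexHull ℝ S := subset_convexHull ℝ _ ⟨i, hi, rfl⟩
    rw [hF] at h
    have h2 := h.2
    rw [dotProduct_smul, smul_eq_mul] at h2
    rcases hσ i hi with h1 | h1 <;> rw [h1] at h2 ⊢ <;> linarith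
  · obtain ⟨c, hc, hcb⟩ : ∃ c : ℝ, (c = 1 ∨ c = -1) ∧ w ⬝ᵥ (c • A.transpose j) = b := by
      rcases eq_or_eq_neg_of_abs_eq hjb with h | h
      · exact ⟨1, Or.inl rfl, by simpa using h⟩
      · exact ⟨-1, Or.inr rfl, by simp [h]⟩
    have hmem := sign_smul_column_mem_signedAtoms A j hc
    have hmemF : c • A.transpose j ∈ convexHull ℝ S := by
      rw [hF]
      exact ⟨subset_convexHull ℝ _ hmem, hcb⟩
    obtain ⟨i, hi, h⟩ := hA.mem_of_mem_convexHull hS hmem hmemF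
    exact hj ((hA.sign_smul_column_inj hc (hσ i hi) h).1 ▸ hi)

/-- Conversely such a functional exposes the hull of the points `σ i • a_i`, `i ∈ s`. -/
theorem isFace_of_certificate {d n : ℕ} {A : Matrix (Fin d) (Fin n) ℝ}
    {s : Finset (Fin n)} {σ : Fin n → ℝ} (hσ : ∀ i ∈ s, σ i = 1 ∨ σ i = -1)
    {w : Fin d → ℝ} {b : ℝ} (hb : 0 < b) (hs : ∀ i ∈ s, w ⬝ᵥ A.transpose i = σ i * b)
    (hsc : ∀ j, j ∉ s → |w ⬝ᵥ A.transpose j| < b) :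
    IsFace (signedAtomPolytope A) (convexHull ℝ {v | ∃ i ∈ s, v = σ i • A.transpose i}) := by
  have hsq : ∀ i ∈ s, σ i * σ i = 1 := fun i hi => by
    rcases hσ i hi with h | h <;> rw [h] <;> norm_num
  have habsσ : ∀ i ∈ s, |σ i| = 1 := fun i hi => by
    rcases hσ i hi with h | h <;> rw [h] <;> norm_num
  have hle : ∀ i, |w ⬝ᵥ A.transpose i| ≤ b := fun i => by
    by_cases hi : i ∈ s
    · rw [hs i hi, abs_mul, habsσ i hi, one_mul, abs_of_pos hb]
    · exact (hsc i hi).le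
  have hterm : ∀ (x : Fin n → ℝ) i, x i * (w ⬝ᵥ A.transpose i) ≤ |x i| * b := fun x i =>
    (le_abs_self _).trans (by rw [abs_mul]; exact mul_le_mul_of_nonneg_left (hle i) (abs_nonneg _))
  refine Or.inr ⟨w, b, fun z hz => ?_, Set.Subset.antisymm ?_ ?_⟩
  · obtain ⟨x, ⟨hx, -⟩, rfl⟩ := signedAtomPolytope_subset_crossImageOff_empty A hz
    rw [dotProduct_mulVec_eq_sum_column]
    calc _ ≤ ∑ i, |x i| * b := Finset.sum_le_sum fun i _ => hterm x i
      _ = (∑ i, |x i|) * b := (Finset.sum_mul _ _ _).symm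
      _ ≤ 1 * b := by gcongr
      _ = b := one_mul b
  · refine convexHull_min ?_ ((convex_convexHull ℝ _).inter (convex_hyperplane
      ⟨fun x y => dotProduct_add w x y, fun c x => dotProduct_smul c w x⟩ b))
    rintro v ⟨i, hi, rfl⟩
    refine ⟨subset_convexHull ℝ _ (sign_smul_column_mem_signedAtoms A i (hσ i hi)), ?_⟩
    rw [dotProduct_smul, hs i hi, smul_eq_mul, ← mul_assoc, hsq i hi, one_mul]
  · rintro z ⟨hz, hzb⟩
    obtain ⟨x, ⟨hx, -⟩, rfl⟩ := signedAtomPolytope_subset_crossImageOff_empty A hz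
    rw [dotProduct_mulVec_eq_sum_column] at hzb
    have hsum : ∑ i, |x i| * b ≤ ∑ i, x i * (w ⬝ᵥ A.transpose i) := by
      rw [hzb, ← Finset.sum_mul]
      exact mul_le_of_le_one_left hb.le hx
    have heq : ∀ i, x i * (w ⬝ᵥ A.transpose i) = |x i| * b := fun i =>
      (Finset.sum_eq_sum_iff_of_le fun i _ => hterm x i).1
        (le_antisymm (Finset.sum_le_sum fun i _ => hterm x i) hsum) i (Finset.mem_univ i)
    have hoff : ∀ i, i ∉ s → x i = 0 := by
      intro i hi
      by_contra h0
      have h1 : x i * (w ⬝ᵥ A.transpose i) ≤ |x i| * |w ⬝ᵥ A.transpose i| := by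
        rw [← abs_mul]; exact le_abs_self _
      have h2 := mul_lt_mul_of_pos_left (hsc i hi) (abs_pos.2 h0)
      linarith [heq i]
    have hon : ∀ i ∈ s, x i * σ i = |x i| := fun i hi => by
      have h := heq i
      rw [hs i hi, ← mul_assoc] at h
      exact mul_right_cancel₀ hb.ne' h
    have hone : ∑ i ∈ s, x i * σ i = 1 := by
      have h1 : ∑ i, |x i| = 1 := by
        have h : (∑ i, |x i|) * b = 1 * b := by
          rw [Finset.sum_mul, one_mul]
          exact (Finset.sum_congr rfl fun i _ => (heq i).symm).trans hzb
        exact mul_right_cancel₀ hb.ne' h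
      rw [Finset.sum_congr rfl hon, ← h1]
      exact Finset.sum_subset (Finset.subset_univ s) fun i _ hi => by rw [hoff i hi, abs_zero]
    have hz : A *ᵥ x = ∑ i ∈ s, (x i * σ i) • (σ i • A.transpose i) := by
      rw [mulVec_eq_sum_smul_column_of_support A hoff]
      refine Finset.sum_congr rfl fun i hi => ?_
      rw [smul_smul, mul_assoc, hsq i hi, mul_one]
    change A *ᵥ x ∈ _
    rw [hz]
    exact (convex_convexHull ℝ _).sum_mem (fun i hi => by rw [hon i hi]; exact abs_nonneg _) hone
      fun i hi => subset_convexHull ℝ _ ⟨i, hi, rfl⟩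

/-- Affinely independent points on a hyperplane `w z = b`, `b ≠ 0`, are linearly independent. -/
theorem eq_zero_of_mulVec_eq_zero_of_certificate {d n : ℕ} {A : Matrix (Fin d) (Fin n) ℝ}
    {s : Finset (Fin n)} {σ : Fin n → ℝ} (hσ : ∀ i ∈ s, σ i = 1 ∨ σ i = -1)
    (hind : AffineIndependent ℝ (fun i : s => σ i.val • A.transpose i.val))
    {w : Fin d → ℝ} {b : ℝ} (hb : 0 < b) (hs : ∀ i ∈ s, w ⬝ᵥ A.transpose i = σ i * b)
    {h : Fin n → ℝ} (hoff : ∀ i, i ∉ s → h i = 0) (hker : A *ᵥ h = 0) : h = 0 := by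
  have hsq : ∀ i ∈ s, σ i * σ i = 1 := fun i hi => by
    rcases hσ i hi with h | h <;> rw [h] <;> norm_num
  have hsum : ∑ i ∈ s, h i * σ i = 0 := by
    have h1 : w ⬝ᵥ (A *ᵥ h) = 0 := by rw [hker, dotProduct_zero]
    rw [mulVec_eq_sum_smul_column_of_support A hoff, dotProduct_sum,
      Finset.sum_congr rfl (fun i hi => by
        rw [dotProduct_smul, hs i hi, smul_eq_mul, ← mul_assoc]), ← Finset.sum_mul] at h1
    exact (mul_eq_zero.1 h1).resolve_right hb.ne'
  have hzero := (affineIndependent_iff.1 hind) Finset.univ (fun i => h i.val * σ i.val)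
    (by rw [Finset.sum_coe_sort s fun i => h i * σ i, hsum])
    (by
      rw [Finset.sum_coe_sort s fun i => (h i * σ i) • (σ i • A.transpose i), ← hker,
        mulVec_eq_sum_smul_column_of_support A hoff]
      refine Finset.sum_congr rfl fun i hi => ?_
      rw [smul_smul, mul_assoc, hsq i hi, mul_one])
  funext i
  by_cases hi : i ∈ s
  · have h1 : h i * σ i = 0 := hzero ⟨i, hi⟩ (Finset.mem_univ _)
    have h2 := hsq i hi
    rcases mul_eq_zero.1 h1 with h3 | h3
    · exact h3
    · rw [h3, mul_zero] at h2
      exact absurd h2 zero_ne_one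
  · exact hoff i hi

/-- Dual certificates imply unique recovery. -/
theorem isUniqueL1Minimizer_of_certificate {d n : ℕ} {A : Matrix (Fin d) (Fin n) ℝ}
    {s : Finset (Fin n)} {σ : Fin n → ℝ} (hσ : ∀ i ∈ s, σ i = 1 ∨ σ i = -1)
    (hind : AffineIndependent ℝ (fun i : s => σ i.val • A.transpose i.val))
    {w : Fin d → ℝ} {b : ℝ} (hb : 0 < b) (hs : ∀ i ∈ s, w ⬝ᵥ A.transpose i = σ i * b)
    (hsc : ∀ j, j ∉ s → |w ⬝ᵥ A.transpose j| < b) {x₀ : Fin n → ℝ}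
    (hoff : ∀ i, i ∉ s → x₀ i = 0) (hsign : ∀ i ∈ s, x₀ i * σ i = |x₀ i|) :
    IsUniqueL1Minimizer A (A *ᵥ x₀) x₀ := by
  have hle : ∀ i, |w ⬝ᵥ A.transpose i| ≤ b := fun i => by
    by_cases hi : i ∈ s
    · rw [hs i hi, abs_mul, abs_of_pos hb]
      rcases hσ i hi with h | h <;> simp [h]
    · exact (hsc i hi).le
  have hterm : ∀ (x : Fin n → ℝ) i, x i * (w ⬝ᵥ A.transpose i) ≤ |x i| * b := fun x i =>
    (le_abs_self _).trans (by rw [abs_mul]; exact mul_le_mul_of_nonneg_left (hle i) (abs_nonneg _))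
  have hx₀ : w ⬝ᵥ (A *ᵥ x₀) = ∑ i, |x₀ i| * b := by
    rw [dotProduct_mulVec_eq_sum_column]
    refine Finset.sum_congr rfl fun i _ => ?_
    by_cases hi : i ∈ s
    · rw [hs i hi, ← mul_assoc, hsign i hi]
    · simp [hoff i hi]
  have hmin : IsL1Minimizer A (A *ᵥ x₀) x₀ := by
    refine ⟨rfl, fun x hx => le_of_mul_le_mul_right ?_ hb⟩
    rw [Finset.sum_mul, Finset.sum_mul, ← hx₀, ← hx, dotProduct_mulVec_eq_sum_column]
    exact Finset.sum_le_sum fun i _ => hterm x i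
  refine ⟨hmin, fun x hx => ?_⟩
  have hsum : ∑ i, |x i| * b ≤ ∑ i, x i * (w ⬝ᵥ A.transpose i) := by
    rw [← dotProduct_mulVec_eq_sum_column, hx.1, hx₀, ← Finset.sum_mul, ← Finset.sum_mul]
    exact mul_le_mul_of_nonneg_right (hx.2 x₀ rfl) hb.le
  have heq : ∀ i, x i * (w ⬝ᵥ A.transpose i) = |x i| * b := fun i =>
    (Finset.sum_eq_sum_iff_of_le fun i _ => hterm x i).1
      (le_antisymm (Finset.sum_le_sum fun i _ => hterm x i) hsum) i (Finset.mem_univ i)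
  have hxoff : ∀ i, i ∉ s → x i = 0 := by
    intro i hi
    by_contra h0
    have h1 : x i * (w ⬝ᵥ A.transpose i) ≤ |x i| * |w ⬝ᵥ A.transpose i| := by
      rw [← abs_mul]; exact le_abs_self _
    have h2 := mul_lt_mul_of_pos_left (hsc i hi) (abs_pos.2 h0)
    linarith [heq i]
  refine sub_eq_zero.1 (eq_zero_of_mulVec_eq_zero_of_certificate hσ hind hb hs (h := x - x₀)
    (fun i hi => ?_) ?_)
  · simp [hxoff i hi, hoff i hi]
  · rw [Matrix.mulVec_sub, hx.1, sub_self]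

theorem Neighbourly.isUniqueL1Minimizer {d n : ℕ} {A : Matrix (Fin d) (Fin n) ℝ}
    (hA : HasAllVertices A) {k : ℕ} (hk : k ≤ n) (hN : Neighbourly A k) (x₀ : Fin n → ℝ)
    (hx₀ : (Finset.univ.filter fun i => x₀ i ≠ 0).card ≤ k) :
    IsUniqueL1Minimizer A (A *ᵥ x₀) x₀ := by
  rcases Nat.eq_zero_or_pos n with rfl | hn
  · exact ⟨⟨rfl, fun x _ => by simp⟩, fun x _ => Subsingleton.elim _ _⟩
  obtain ⟨s, hsub, hcard⟩ := Finset.exists_superset_card_eq hx₀ (by simpa using hk)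
  let σ : Fin n → ℝ := fun i => if 0 ≤ x₀ i then 1 else -1
  have hσ : ∀ i ∈ s, σ i = 1 ∨ σ i = -1 := fun i _ => by
    by_cases h : 0 ≤ x₀ i <;> simp [σ, h]
  obtain ⟨hind, hF⟩ := hN s hcard σ hσ
  obtain ⟨w, b, hb, hs, hsc⟩ := hA.exists_certificate_of_isFace hn hσ hF
  refine isUniqueL1Minimizer_of_certificate hσ hind hb hs hsc (fun i hi => ?_) fun i _ => ?_
  · by_contra h
    exact hi (hsub (by simpa using h))
  · by_cases h : 0 ≤ x₀ i
    · simp [σ, h, abs_of_nonneg h]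
    · simp [σ, h, abs_of_neg (not_le.1 h)]

/-- Unique recovery of sparse vectors makes any `k` columns linearly independent. -/
theorem eq_zero_of_mulVec_eq_zero_of_recovery {d n : ℕ} {A : Matrix (Fin d) (Fin n) ℝ} {k : ℕ}
    (hR : ∀ x₀ : Fin n → ℝ, (Finset.univ.filter fun i => x₀ i ≠ 0).card ≤ k →
      IsUniqueL1Minimizer A (A *ᵥ x₀) x₀)
    {s : Finset (Fin n)} (hcard : s.card = k) {h : Fin n → ℝ} (hoff : ∀ i, i ∉ s → h i = 0)
    (hker : A *ᵥ h = 0) : h = 0 := by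
  have h1 := hR h ((card_filter_ne_zero_le hoff).trans_eq hcard)
  have h2 := hR 0 (by simp)
  rw [hker] at h1
  rw [Matrix.mulVec_zero] at h2
  exact h2.2 h h1.1

theorem affineIndependent_of_recovery {d n : ℕ} {A : Matrix (Fin d) (Fin n) ℝ} {k : ℕ}
    (hR : ∀ x₀ : Fin n → ℝ, (Finset.univ.filter fun i => x₀ i ≠ 0).card ≤ k →
      IsUniqueL1Minimizer A (A *ᵥ x₀) x₀)
    {s : Finset (Fin n)} (hcard : s.card = k) {σ : Fin n → ℝ}
    (hσ : ∀ i ∈ s, σ i = 1 ∨ σ i = -1) :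
    AffineIndependent ℝ (fun i : s => σ i.val • A.transpose i.val) := by
  classical
  refine LinearIndependent.affineIndependent ℝ (Fintype.linearIndependent_iff.2 fun g hg i => ?_)
  let h : Fin n → ℝ := fun j => if hj : j ∈ s then g ⟨j, hj⟩ * σ j else 0
  have hoff : ∀ j, j ∉ s → h j = 0 := fun j hj => dif_neg hj
  have hker : A *ᵥ h = 0 := by
    rw [mulVec_eq_sum_smul_column_of_support A hoff, ← Finset.sum_coe_sort s, ← hg]
    refine Finset.sum_congr rfl fun j _ => ?_
    simp [h, smul_smul]
  have hi := congrFun (eq_zero_of_mulVec_eq_zero_of_recovery hR hcard hoff hker) i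
  have hi' : g i * σ i = 0 := by simpa [h] using hi
  rcases mul_eq_zero.1 hi' with h3 | h3
  · exact h3
  · rcases hσ i i.2 with h4 | h4 <;> rw [h3] at h4 <;> norm_num at h4

/-- The coefficient vectors `c` supported on `s` with `∑ i ∈ s, σ i * c i = 0`. -/
def signBalanced {n : ℕ} (s : Finset (Fin n)) (σ : Fin n → ℝ) : Submodule ℝ (Fin n → ℝ) where
  carrier := {c | (∀ i, i ∉ s → c i = 0) ∧ ∑ i ∈ s, σ i * c i = 0}
  add_mem' := by
    rintro a b ⟨ha, ha'⟩ ⟨hb, hb'⟩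
    refine ⟨fun i hi => by simp [ha i hi, hb i hi], ?_⟩
    simp [mul_add, Finset.sum_add_distrib, ha', hb']
  zero_mem' := ⟨fun _ _ => rfl, by simp⟩
  smul_mem' := by
    rintro r a ⟨ha, ha'⟩
    refine ⟨fun i hi => by simp [ha i hi], ?_⟩
    have h : ∑ i ∈ s, σ i * (r • a) i = r * ∑ i ∈ s, σ i * a i := by
      rw [Finset.mul_sum]
      exact Finset.sum_congr rfl fun i _ => by simp only [Pi.smul_apply, smul_eq_mul]; ring
    rw [h, ha', mul_zero]

/-- A linear functional bounded below on a translate of a submodule vanishes on the submodule. -/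
theorem apply_eq_zero_of_bddBelow_on_translate {E : Type*} [AddCommGroup E] [Module ℝ E]
    (f : E →ₗ[ℝ] ℝ) (N : Submodule ℝ E) {p : E} {v : ℝ} (h : ∀ z ∈ N, v < f (p + z)) {z : E}
    (hz : z ∈ N) : f z = 0 := by
  by_contra h0
  have h1 := h _ (N.smul_mem ((v - f p) / f z) hz)
  rw [map_add, map_smul, smul_eq_mul, div_mul_cancel₀ _ h0] at h1
  linarith

/-- Unique recovery of sparse vectors gives dual certificates, by separating the affine span of
the points `σ i • a_i`, `i ∈ s`, from the hull of the remaining signed atoms. -/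
theorem exists_certificate_of_recovery {d n : ℕ} {A : Matrix (Fin d) (Fin n) ℝ} {k : ℕ}
    (hR : ∀ x₀ : Fin n → ℝ, (Finset.univ.filter fun i => x₀ i ≠ 0).card ≤ k →
      IsUniqueL1Minimizer A (A *ᵥ x₀) x₀)
    {s : Finset (Fin n)} (hcard : s.card = k) (hne : s.Nonempty) {σ : Fin n → ℝ}
    (hσ : ∀ i ∈ s, σ i = 1 ∨ σ i = -1) :
    ∃ (w : Fin d → ℝ) (b : ℝ), 0 < b ∧ (∀ i ∈ s, w ⬝ᵥ A.transpose i = σ i * b) ∧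
      ∀ j, j ∉ s → |w ⬝ᵥ A.transpose j| < b := by
  classical
  have hsq : ∀ i ∈ s, σ i * σ i = 1 := fun i hi => by
    rcases hσ i hi with h | h <;> rw [h] <;> norm_num
  obtain ⟨i₀, hi₀⟩ := hne
  let e : Fin n → Fin n → ℝ := fun i => Pi.single i (σ i)
  have hAe : ∀ i, A *ᵥ e i = σ i • A.transpose i := fun i => by
    ext j; simp [e, mul_comm]
  have heoff : ∀ i ∈ s, ∀ j, j ∉ s → e i j = 0 := fun i hi j hj =>
    Pi.single_eq_of_ne (by rintro rfl; exact hj hi) _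
  have hesum : ∀ i ∈ s, ∑ j ∈ s, σ j * e i j = 1 := fun i hi => by
    rw [Finset.sum_eq_single i (fun j _ hji => by simp [e, hji]) (fun h => absurd hi h)]
    simpa [e] using hsq i hi
  let N : Submodule ℝ (Fin d → ℝ) := (signBalanced s σ).map A.mulVecLin
  let M : Set (Fin d → ℝ) := {z | z - A *ᵥ e i₀ ∈ N}
  have hMclosed : IsClosed M :=
    N.closed_of_finiteDimensional.preimage (continuous_id.sub continuous_const)
  have hMconvex : Convex ℝ M := by
    intro z hz z' hz' a b _ _ hab
    have h : a • z + b • z' - A *ᵥ e i₀ = a • (z - A *ᵥ e i₀) + b • (z' - A *ᵥ e i₀) := by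
      have hab' : A *ᵥ e i₀ = (a + b) • (A *ᵥ e i₀) := by rw [hab, one_smul]
      nth_rewrite 1 [hab']
      module
    change a • z + b • z' - A *ᵥ e i₀ ∈ N
    rw [h]
    exact N.add_mem (N.smul_mem a hz) (N.smul_mem b hz')
  have hdisj : Disjoint (crossImageOff A s) M := by
    rw [Set.disjoint_left]
    rintro _ ⟨x, ⟨hx, hxs⟩, rfl⟩ ⟨c', hc', hc'eq⟩
    obtain ⟨hc'off, hc'sum⟩ := hc'
    have hA' : A *ᵥ (c' + e i₀) = A *ᵥ x := by
      rw [Matrix.mulVec_add]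
      exact add_eq_of_eq_sub hc'eq
    have hoff : ∀ i, i ∉ s → (c' + e i₀) i = 0 := fun i hi => by
      simp [hc'off i hi, heoff i₀ hi₀ i hi]
    have hsum : ∑ i ∈ s, σ i * (c' + e i₀) i = 1 := by
      simp only [Pi.add_apply, mul_add, Finset.sum_add_distrib]
      rw [hc'sum, hesum i₀ hi₀, zero_add]
    have hnorm : 1 ≤ ∑ i, |(c' + e i₀) i| := by
      rw [← hsum]
      refine (Finset.sum_le_sum fun i hi => ?_).trans
        (Finset.sum_le_sum_of_subset_of_nonneg (Finset.subset_univ s) fun _ _ _ => abs_nonneg _)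
      refine (le_abs_self _).trans_eq ?_
      rw [abs_mul]
      rcases hσ i hi with h | h <;> simp [h]
    have hu := hR (c' + e i₀) ((card_filter_ne_zero_le hoff).trans_eq hcard)
    have hxc : x = c' + e i₀ := hu.2 x ⟨hA'.symm, fun x' hx' =>
      (hx.trans hnorm).trans (hu.1.2 x' hx')⟩
    have : ∑ i ∈ s, σ i * (c' + e i₀) i = 0 := by
      rw [← hxc]
      exact Finset.sum_eq_zero fun i hi => by rw [hxs i hi, mul_zero]
    linarith
  obtain ⟨f, u, v, hfu, huv, hfv⟩ := geometric_hahn_banach_compact_closed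
    (convex_crossImageOff A s) (isCompact_crossImageOff A s) hMconvex hMclosed hdisj
  have hfN : ∀ z ∈ N, f z = 0 := fun z hz =>
    apply_eq_zero_of_bddBelow_on_translate f.toLinearMap N (p := A *ᵥ e i₀) (v := v)
      (fun z hz => hfv _ (by simpa [M] using hz)) hz
  have hfi : ∀ i ∈ s, f (σ i • A.transpose i) = f (A *ᵥ e i₀) := fun i hi => by
    rw [← sub_eq_zero, ← map_sub, ← hAe i, ← Matrix.mulVec_sub]
    refine hfN _ ⟨e i - e i₀, ⟨fun j hj => ?_, ?_⟩, rfl⟩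
    · simp [heoff i hi j hj, heoff i₀ hi₀ j hj]
    · simp only [Pi.sub_apply, mul_sub, Finset.sum_sub_distrib]
      rw [hesum i hi, hesum i₀ hi₀, sub_self]
  have hub : u < f (A *ᵥ e i₀) := huv.trans (hfv _ (by simp [M]))
  have hu0 : 0 < u := by
    have h := hfu 0 ⟨0, ⟨by simp, fun _ _ => rfl⟩, by simp⟩
    rwa [map_zero] at h
  let w : Fin d → ℝ := fun j => f (Pi.single j 1)
  have hw : ∀ z, w ⬝ᵥ z = f z := fun z => by
    conv_rhs => rw [pi_eq_sum_univ' z, map_sum]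
    simp [w, dotProduct, mul_comm]
  refine ⟨w, f (A *ᵥ e i₀), hu0.trans hub, fun i hi => ?_, fun j hj => ?_⟩
  · rw [hw, ← hfi i hi, map_smul, smul_eq_mul, ← mul_assoc, hsq i hi, one_mul]
  · rw [hw, abs_lt]
    have h1 := hfu _ (smul_column_mem_crossImageOff A hj (c := 1) (by simp))
    have h2 := hfu _ (smul_column_mem_crossImageOff A hj (c := -1) (by simp))
    rw [map_smul, smul_eq_mul] at h1 h2
    constructor <;> linarith

/-- Let `P = conv{±a_1, …, ±a_n}` have the `2n` signed atoms as its `2n` vertices, and let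
`k ≤ n`. Then `P` is `k`-neighbourly if and only if for every `y`, every solution `x0` of
`A x0 = y` with at most `k` nonzero entries is the unique minimizer of `‖x‖₁` over
`{x : A x = y}`. -/
theorem neighbourly_iff_l1_recovery {d n : ℕ} (A : Matrix (Fin d) (Fin n) ℝ)
    (hA : HasAllVertices A) (k : ℕ) (hk : k ≤ n) :
    Neighbourly A k ↔
      ∀ (y : Fin d → ℝ) (x0 : Fin n → ℝ), A *ᵥ x0 = y →
        (Finset.univ.filter fun i => x0 i ≠ 0).card ≤ k →
        IsUniqueL1Minimizer A y x0 := by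
  constructor
  · rintro hN _ x₀ rfl hx₀
    exact hN.isUniqueL1Minimizer hA hk x₀ hx₀
  · intro h s hcard σ hσ
    have hR : ∀ x₀ : Fin n → ℝ, (Finset.univ.filter fun i => x₀ i ≠ 0).card ≤ k →
        IsUniqueL1Minimizer A (A *ᵥ x₀) x₀ := fun x₀ => h _ x₀ rfl
    refine ⟨affineIndependent_of_recovery hR hcard hσ, ?_⟩
    rcases s.eq_empty_or_nonempty with rfl | hne
    · exact Or.inr ⟨0, 1, by simp, by simp⟩
    · obtain ⟨w, b, hb, hs, hsc⟩ := exists_certificate_of_recovery hR hcard hne hσ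
      exact isFace_of_certificate hσ hb hs hsc
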